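/- Under Condition (B) (Q₂(n) = o(nQ₁(n))), let g*(n) be an integer-valued function satisfying Q₂(g*(n)) ~ Q₂₁(n). Then for any s₁, s₂ ∈ (0,1) and any integer sequence m = m(n) with 1 ≤ m(n) ≪ g*(n), one has lim_{n→∞} E[s₁^{Z₁(m,n)} s₂^{Z₂(m,n)} | Z(n) ≠ 0, Z(0)=e₂] = s₂. -/

import Mathlib

open MeasureTheory Filter Topology

/-- `a(n) ~ b(n)` : the ratio tends to `1` as `n → ∞`. -/
def Asymp (f g : ℕ → ℝ) : Prop :=
  Filter.Tendsto (fun n => f n / g n) Filter.atTop (nhds 1)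

/-- A critical decomposable two-type Galton–Watson process together with its
reduced process.  `P1` is the law of the process started from one particle of
type 1 (`Z(0) = e₁`), `P2` the law started from one particle of type 2
(`Z(0) = e₂`).  `Z1 n`/`Z2 n` are the numbers of particles of types 1 and 2 at
time `n`; `R1 m n`/`R2 m n` are the numbers of particles of types 1 and 2 alive
at time `m` having descendants at time `n` (the reduced process). -/
structure GWSetup where
  (Ω : Type)
  [mΩ : MeasurableSpace Ω]
  (P1 : Measure Ω)
  (P2 : Measure Ω)
  (hprob1 : IsProbabilityMeasure P1)
  (hprob2 : IsProbabilityMeasure P2)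
  (Z1 : ℕ → Ω → ℕ)
  (Z2 : ℕ → Ω → ℕ)
  (R1 : ℕ → ℕ → Ω → ℕ)
  (R2 : ℕ → ℕ → Ω → ℕ)
  (mZ1 : ∀ n, Measurable (Z1 n))
  (mZ2 : ∀ n, Measurable (Z2 n))
  (mR1 : ∀ m n, Measurable (R1 m n))
  (mR2 : ∀ m n, Measurable (R2 m n))
  (α1 : ℝ)
  (α2 : ℝ)
  (A21 : ℝ)
  (L1 : ℝ → ℝ)
  (L2 : ℝ → ℝ)
  (ρ : ℝ → ℝ → ℝ)
  (hα1 : 0 < α1 ∧ α1 ≤ 1)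
  (hα2 : 0 < α2 ∧ α2 ≤ 1)
  (hA21 : 0 < A21)
  -- initial states
  (hinit1 : ∀ᵐ ω ∂P1, Z1 0 ω = 1 ∧ Z2 0 ω = 0)
  (hinit2 : ∀ᵐ ω ∂P2, Z1 0 ω = 0 ∧ Z2 0 ω = 1)
  -- type-1 particles produce only type-1 particles
  (hdecomp : ∀ n, ∀ᵐ ω ∂P1, Z2 n ω = 0)
  -- criticality
  (hcrit1 : (∫ ω, (Z1 1 ω : ℝ) ∂P1) = 1)
  (hcrit2 : (∫ ω, (Z2 1 ω : ℝ) ∂P2) = 1)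
  -- mean number of type-1 children of a type-2 particle
  (hmean21 : (∫ ω, (Z1 1 ω : ℝ) ∂P2) = A21)
  -- assumption (F1)
  (hF1 : ∀ s : ℝ, 0 ≤ s → s < 1 →
    (∫ ω, s ^ Z1 1 ω ∂P1) = s + (1 - s) ^ (1 + α1) * L1 (1 - s))
  -- assumption (F2)
  (hF2 : ∀ s1 s2 : ℝ, 0 ≤ s1 → s1 ≤ 1 → 0 ≤ s2 → s2 < 1 →
    (∫ ω, s1 ^ Z1 1 ω * s2 ^ Z2 1 ω ∂P2) =
      s2 + (1 - s2) ^ (1 + α2) * L2 (1 - s2) - (A21 - ρ s1 s2) * (1 - s1))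
  -- `L1`, `L2` are slowly varying at `0`
  (hL1 : ∀ c : ℝ, 0 < c →
    Filter.Tendsto (fun x => L1 (c * x) / L1 x) (nhdsWithin 0 (Set.Ioi 0)) (nhds 1))
  (hL2 : ∀ c : ℝ, 0 < c →
    Filter.Tendsto (fun x => L2 (c * x) / L2 x) (nhdsWithin 0 (Set.Ioi 0)) (nhds 1))
  -- `ρ(s₁,s₂) → 0` as `s₁ s₂ ↑ 1`
  (hρ : ∀ ε : ℝ, 0 < ε → ∃ δ : ℝ, 0 < δ ∧ ∀ s1 s2 : ℝ,
    0 ≤ s1 → s1 ≤ 1 → 0 ≤ s2 → s2 ≤ 1 → 1 - δ < s1 * s2 → |ρ s1 s2| < ε)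
  -- branching (semigroup) property at the level of generating functions
  (hbranch1 : ∀ m n : ℕ, ∀ s : ℝ, 0 ≤ s → s ≤ 1 →
    (∫ ω, s ^ Z1 (m + n) ω ∂P1) = ∫ ω, (∫ ω', s ^ Z1 n ω' ∂P1) ^ Z1 m ω ∂P1)
  (hbranch2 : ∀ m n : ℕ, ∀ s1 s2 : ℝ, 0 ≤ s1 → s1 ≤ 1 → 0 ≤ s2 → s2 ≤ 1 →
    (∫ ω, s1 ^ Z1 (m + n) ω * s2 ^ Z2 (m + n) ω ∂P2) =
      ∫ ω, (∫ ω', s1 ^ Z1 n ω' ∂P1) ^ Z1 m ω *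
        (∫ ω', s1 ^ Z1 n ω' * s2 ^ Z2 n ω' ∂P2) ^ Z2 m ω ∂P2)
  -- the reduced process vanishes on the extinction event
  (hext : ∀ m n : ℕ, ∀ᵐ ω ∂P2,
    (Z1 n ω = 0 ∧ Z2 n ω = 0) → (R1 m n ω = 0 ∧ R2 m n ω = 0))
  -- the generating function of the reduced process (conditioning on `Z(m)`)
  (hreduced : ∀ m n : ℕ, m ≤ n → ∀ s1 s2 : ℝ, 0 ≤ s1 → s1 ≤ 1 → 0 ≤ s2 → s2 ≤ 1 →
    (∫ ω, s1 ^ R1 m n ω * s2 ^ R2 m n ω ∂P2) =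
      ∫ ω, (1 - (1 - s1) * (P1 {ω' | Z1 (n - m) ω' ≠ 0}).toReal) ^ Z1 m ω *
        (1 - (1 - s2) *
          (P2 {ω' | Z1 (n - m) ω' ≠ 0 ∨ Z2 (n - m) ω' ≠ 0}).toReal) ^ Z2 m ω ∂P2)

namespace GWSetup

variable (S : GWSetup)

/-- The survival event `{Z(n) ≠ 0}` (under the law `P2`). -/
def surv (n : ℕ) : Set S.Ω := {ω | S.Z1 n ω ≠ 0 ∨ S.Z2 n ω ≠ 0}

/-- `Q₁(n) = P(Z₁(n) > 0 | Z(0) = e₁)`. -/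
noncomputable def Q1 (n : ℕ) : ℝ := (S.P1 {ω | S.Z1 n ω ≠ 0}).toReal

/-- `Q₂(n) = P(Z₂(n) > 0 | Z(0) = e₂)`. -/
noncomputable def Q2 (n : ℕ) : ℝ := (S.P2 {ω | S.Z2 n ω ≠ 0}).toReal

/-- `Q₂₁(n) = P(Z(n) ≠ 0 | Z(0) = e₂)`. -/
noncomputable def Q21 (n : ℕ) : ℝ := (S.P2 (S.surv n)).toReal

/-- `F₁(n; s) = E[s^{Z₁(n)} | Z(0) = e₁]`. -/
noncomputable def F1 (n : ℕ) (s : ℝ) : ℝ := ∫ ω, s ^ S.Z1 n ω ∂S.P1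

/-- `F₂₁(n; s₁, s₂) = E[s₁^{Z₁(n)} s₂^{Z₂(n)} | Z(0) = e₂]`. -/
noncomputable def F21 (n : ℕ) (s1 s2 : ℝ) : ℝ :=
  ∫ ω, s1 ^ S.Z1 n ω * s2 ^ S.Z2 n ω ∂S.P2

/-- `Q₁(n; s) = 1 - F₁(n; s)`. -/
noncomputable def Q1s (n : ℕ) (s : ℝ) : ℝ := 1 - S.F1 n s

/-- `Q₂(n; s) = 1 - E[s^{Z₂(n)} | Z(0) = e₂]`. -/
noncomputable def Q2s (n : ℕ) (s : ℝ) : ℝ := 1 - S.F21 n 1 s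

/-- `Q₂₁(n; s₁, s₂) = 1 - F₂₁(n; s₁, s₂)`. -/
noncomputable def Q21s (n : ℕ) (s1 s2 : ℝ) : ℝ := 1 - S.F21 n s1 s2

/-- The conditional expectation
`E[f(Z₁(m,n), Z₂(m,n)) | Z(n) ≠ 0, Z(0) = e₂]` for the reduced process. -/
noncomputable def Ered (m n : ℕ) (f : ℕ → ℕ → ℝ) : ℝ :=
  (∫ ω in S.surv n, f (S.R1 m n ω) (S.R2 m n ω) ∂S.P2) / S.Q21 n

/-- The conditional probability `P(E | Z(n) ≠ 0, Z(0) = e₂)`. -/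
noncomputable def Pred (n : ℕ) (E : Set S.Ω) : ℝ :=
  (S.P2 (E ∩ S.surv n)).toReal / S.Q21 n

/-- The birth time `β_n` of the most recent common ancestor of the population
alive at time `n`:  `β_n = max {m < n : Z₁(m,n) + Z₂(m,n) = 1}`. -/
noncomputable def beta (n : ℕ) (ω : S.Ω) : ℕ :=
  sSup {m | m < n ∧ S.R1 m n ω + S.R2 m n ω = 1}

/-- The type `T_n` of the most recent common ancestor: the `i ∈ {1,2}` with
`Z_i(β_n, n) = 1`. -/
noncomputable def mrcaType (n : ℕ) (ω : S.Ω) : ℕ :=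
  if S.R2 (S.beta n ω) n ω = 1 then 2 else 1

/-- Condition (A): `n Q₁(n) = o(Q₂(n))`. -/
def CondA : Prop :=
  Filter.Tendsto (fun n : ℕ => (n : ℝ) * S.Q1 n / S.Q2 n) Filter.atTop (nhds 0)

/-- Condition (B): `Q₂(n) = o(n Q₁(n))`. -/
def CondB : Prop :=
  Filter.Tendsto (fun n : ℕ => S.Q2 n / ((n : ℝ) * S.Q1 n)) Filter.atTop (nhds 0)

/-- Condition (C): `n Q₁(n) ~ σ Q₂(n)`. -/
def CondC (σ : ℝ) : Prop := Asymp (fun n : ℕ => (n : ℝ) * S.Q1 n) (fun n => σ * S.Q2 n)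

/-- `h*` is an integer-valued function with
`(α₁ A₂₁ / (1 - α₁)) h*(n) Q₁(h*(n)) ~ Q₂(n)`. -/
def IsHStar (h : ℕ → ℕ) : Prop :=
  Asymp (fun n : ℕ => S.α1 * S.A21 / (1 - S.α1) * (h n : ℝ) * S.Q1 (h n)) S.Q2

/-- `g*` is an integer-valued function with `Q₂(g*(n)) ~ Q₂₁(n)`. -/
def IsGStar (g : ℕ → ℕ) : Prop := Asymp (fun n => S.Q2 (g n)) S.Q21

end GWSetup

/-- The relative rate `φ` of decrease of the survival probability of a critical branching
process: the survival probabilities obey `u (k + 1) = u k * (1 - φ (u k))`. -/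
structure IsCritRate (φ : ℝ → ℝ) : Prop where
  pos : ∀ x, 0 < x → x ≤ 1 → 0 < φ x
  lt_one : ∀ x, 0 < x → x ≤ 1 → φ x < 1
  mono : ∀ x y, 0 < x → x ≤ y → y ≤ 1 → φ x ≤ φ y
  step_mono : ∀ x y, 0 ≤ x → x ≤ y → y ≤ 1 → x * (1 - φ x) ≤ y * (1 - φ y)
  double : ∃ C > 0, ∃ δ > 0, ∀ x, 0 < x → x ≤ δ → φ (2 * x) ≤ C * φ x
  halve : ∃ θ < 1, ∃ δ > 0, ∀ x, 0 < x → x ≤ δ → φ (x / 2) ≤ θ * φ x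

/-- An orbit of the map `x ↦ x * (1 - φ x)` inside `(0, 1]`. -/
structure IsRateOrbit (φ : ℝ → ℝ) (u : ℕ → ℝ) : Prop where
  pos : ∀ k, 0 < u k
  le_one : ∀ k, u k ≤ 1
  succ : ∀ k, u (k + 1) = u k * (1 - φ (u k))

lemma IsRateOrbit.of_zero {φ : ℝ → ℝ} (hφ : IsCritRate φ) {u : ℕ → ℝ} (h0 : 0 < u 0)
    (h1 : u 0 ≤ 1) (hs : ∀ k, 0 < u k → u k ≤ 1 → u (k + 1) = u k * (1 - φ (u k))) :
    IsRateOrbit φ u := by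
  have key : ∀ k, 0 < u k ∧ u k ≤ 1 := by
    intro k
    induction k with
    | zero => exact ⟨h0, h1⟩
    | succ k ih =>
      obtain ⟨hp, hl⟩ := ih
      rw [hs k hp hl]
      have := hφ.pos _ hp hl
      have := hφ.lt_one _ hp hl
      exact ⟨mul_pos hp (by linarith), by nlinarith⟩
  exact ⟨fun k => (key k).1, fun k => (key k).2, fun k => hs k (key k).1 (key k).2⟩

namespace IsRateOrbit

variable {φ : ℝ → ℝ} {u : ℕ → ℝ}

lemma antitone (hφ : IsCritRate φ) (hu : IsRateOrbit φ u) : Antitone u := by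
  refine antitone_nat_of_succ_le fun k => ?_
  have := hφ.pos _ (hu.pos k) (hu.le_one k)
  rw [hu.succ]
  nlinarith [hu.pos k]

/-- The total decrease over `d` steps is at least `d` times the last decrease rate. -/
lemma mul_rate_le_sub (hφ : IsCritRate φ) (hu : IsRateOrbit φ u) (a d : ℕ) :
    (d : ℝ) * φ (u (a + d)) * u (a + d) ≤ u a - u (a + d) := by
  have key : ∀ j, j ≤ d → (j : ℝ) * φ (u (a + d)) * u (a + d) ≤ u a - u (a + j) := by
    intro j
    induction j with
    | zero => simp
    | succ j ih =>
      intro hj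
      have h1 := ih (by omega)
      have h2 : u (a + d) ≤ u (a + j) := hu.antitone hφ (by omega)
      have h3 := hφ.mono _ _ (hu.pos _) h2 (hu.le_one _)
      have h4 : φ (u (a + d)) * u (a + d) ≤ φ (u (a + j)) * u (a + j) :=
        mul_le_mul h3 h2 (hu.pos _).le ((hφ.pos _ (hu.pos _) (hu.le_one _)).le)
      have h5 := hu.succ (a + j)
      rw [← add_assoc, h5]
      push_cast
      linarith
  exact key d le_rfl

/-- Over `d` steps an orbit loses at most the proportion `d * φ (u a)` of its value. -/
lemma mul_one_sub_le (hφ : IsCritRate φ) (hu : IsRateOrbit φ u) (a d : ℕ) :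
    u a * (1 - d * φ (u a)) ≤ u (a + d) := by
  induction d with
  | zero => simp
  | succ d ih =>
    have h2 : u (a + d) ≤ u a := hu.antitone hφ (by omega)
    have h3 := hφ.mono _ _ (hu.pos _) h2 (hu.le_one _)
    have h4 : φ (u (a + d)) * u (a + d) ≤ φ (u a) * u a :=
      mul_le_mul h3 h2 (hu.pos _).le ((hφ.pos _ (hu.pos _) (hu.le_one _)).le)
    have h5 := hu.succ (a + d)
    rw [← add_assoc, h5]
    push_cast
    linarith

end IsRateOrbit

/-- A perturbed orbit with vanishing immigration tends to `0`. -/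
lemma IsCritRate.tendsto_zero {φ : ℝ → ℝ} (hφ : IsCritRate φ) {u e : ℕ → ℝ}
    (hanti : Antitone u) (hpos : ∀ k, 0 < u k) (hle : ∀ k, u k ≤ 1)
    (hstep : ∀ k, u (k + 1) ≤ u k * (1 - φ (u k)) + e k) (he : Tendsto e atTop (𝓝 0)) :
    Tendsto u atTop (𝓝 0) := by
  have hbdd : BddBelow (Set.range u) := ⟨0, by rintro _ ⟨k, rfl⟩; exact (hpos k).le⟩
  have hlim := tendsto_atTop_ciInf hanti hbdd
  set l := ⨅ k, u k with hl
  have hl0 : 0 ≤ l := ge_of_tendsto' hlim fun k => (hpos k).le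
  have hlu : ∀ k, l ≤ u k := fun k => ciInf_le hbdd k
  rcases hl0.eq_or_lt with h | h
  · rwa [← h] at hlim
  · exfalso
    have hl1 : l ≤ 1 := (hlu 0).trans (hle 0)
    have hφl := hφ.pos l h hl1
    have hb : ∀ k, u (k + 1) ≤ u k - l * φ l + e k := by
      intro k
      have h3 := hφ.mono _ _ h (hlu k) (hle k)
      have h4 : l * φ l ≤ u k * φ (u k) := mul_le_mul (hlu k) h3 hφl.le (hpos k).le
      linarith [hstep k]
    have h1 : Tendsto (fun k => u (k + 1)) atTop (𝓝 l) := (tendsto_add_atTop_iff_nat 1).2 hlim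
    have h2 : Tendsto (fun k => u k - l * φ l + e k) atTop (𝓝 (l - l * φ l + 0)) :=
      (hlim.sub_const _).add he
    have := le_of_tendsto_of_tendsto' h1 h2 hb
    nlinarith

lemma IsRateOrbit.tendsto_zero {φ : ℝ → ℝ} {u : ℕ → ℝ} (hφ : IsCritRate φ)
    (hu : IsRateOrbit φ u) : Tendsto u atTop (𝓝 0) :=
  hφ.tendsto_zero (e := fun _ => 0) (hu.antitone hφ) hu.pos hu.le_one
    (fun k => by simp [hu.succ k]) tendsto_const_nhds

/-- Along an orbit the decrease rate at time `n` is `O(1 / n)`. -/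
lemma IsRateOrbit.exists_mul_rate_le {φ : ℝ → ℝ} {u : ℕ → ℝ} (hφ : IsCritRate φ)
    (hu : IsRateOrbit φ u) : ∃ C > 0, ∀ n : ℕ, (n : ℝ) * φ (u n) ≤ C := by
  obtain ⟨θ, hθ, δ, hδ, hhalf⟩ := hφ.halve
  obtain ⟨N, hN⟩ := eventually_atTop.1 ((hu.tendsto_zero hφ).eventually (Iic_mem_nhds hδ))
  have hanti := hu.antitone hφ
  have hrp : ∀ n, 0 < φ (u n) := fun n => hφ.pos _ (hu.pos n) (hu.le_one n)
  have hrl : ∀ n, φ (u n) < 1 := fun n => hφ.lt_one _ (hu.pos n) (hu.le_one n)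
  have hshort : ∀ a d, u a ≤ 2 * u (a + d) → (d : ℝ) * φ (u (a + d)) ≤ 1 := by
    intro a d h
    have h1 := hu.mul_rate_le_sub hφ a d
    have h2 := hu.pos (a + d)
    by_contra! h3
    nlinarith
  set C := max ((N : ℝ) + 1) (2 / (1 - θ)) with hC
  have hC1 : (N : ℝ) + 1 ≤ C := le_max_left _ _
  have hC2 : θ * C + 2 ≤ C := by
    have h1 : 2 / (1 - θ) ≤ C := le_max_right _ _
    rw [div_le_iff₀ (by linarith)] at h1
    linarith
  refine ⟨C, by positivity, fun n => ?_⟩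
  induction n using Nat.strong_induction_on with
  | _ n ih =>
    rcases lt_or_ge n N with hn | hn
    · have : (n : ℝ) < N := by exact_mod_cast hn
      have : (0 : ℝ) ≤ n := by positivity
      nlinarith [hrp n, hrl n]
    by_cases hcase : 2 * u n ≤ u N
    · obtain ⟨k, hNk, hkn, hk1, hk2⟩ :
          ∃ k, N ≤ k ∧ k < n ∧ 2 * u n ≤ u k ∧ u (k + 1) < 2 * u n := by
        by_contra! hall
        have hbig : 2 * u n ≤ u n :=
          Nat.le_induction (P := fun k _ => k ≤ n → 2 * u n ≤ u k) (fun _ => hcase)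
            (fun k hNk ih hk => hall k hNk (by omega) (ih (by omega))) n hn le_rfl
        linarith [hu.pos n]
      obtain ⟨d, rfl⟩ : ∃ d, n = k + 1 + d := ⟨n - (k + 1), by omega⟩
      have h1 := hshort (k + 1) d hk2.le
      have h2 := ih k (by omega)
      have h3 : φ (u (k + 1 + d)) ≤ φ (u k / 2) :=
        hφ.mono _ _ (hu.pos _) (by linarith) (by linarith [hu.le_one k, hu.pos k])
      have h4 := hhalf (u k) (hu.pos k) (hN k hNk)
      have hθ0 : 0 ≤ θ := by
        by_contra! h
        nlinarith [hrp k, hrp (k + 1 + d)]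
      have h5 : (k : ℝ) * φ (u (k + 1 + d)) ≤ θ * C := by
        calc (k : ℝ) * φ (u (k + 1 + d)) ≤ k * (θ * φ (u k)) := by gcongr; linarith
          _ = θ * (k * φ (u k)) := by ring
          _ ≤ θ * C := by gcongr
      push_cast
      have := hrl (k + 1 + d)
      linarith
    · obtain ⟨d, rfl⟩ : ∃ d, n = N + d := ⟨n - N, by omega⟩
      have h1 := hshort N d (not_le.1 hcase).le
      push_cast
      have : (0 : ℝ) ≤ N := by positivity
      nlinarith [hrp (N + d), hrl (N + d)]

section PGF

variable {Ω : Type*} [MeasurableSpace Ω] {P : Measure Ω} [IsProbabilityMeasure P]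

lemma integrable_pow_mul_pow {Z W : Ω → ℕ} (hZ : Measurable Z) (hW : Measurable W) {a b : ℝ}
    (ha0 : 0 ≤ a) (ha1 : a ≤ 1) (hb0 : 0 ≤ b) (hb1 : b ≤ 1) :
    Integrable (fun ω => a ^ Z ω * b ^ W ω) P := by
  have hm : Measurable (fun ω => a ^ Z ω * b ^ W ω) :=
    ((measurable_from_nat (f := fun k => a ^ k)).comp hZ).mul
      ((measurable_from_nat (f := fun k => b ^ k)).comp hW)
  refine Integrable.of_bound hm.aestronglyMeasurable 1 (ae_of_all _ fun ω => ?_)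
  rw [Real.norm_of_nonneg (by positivity)]
  exact mul_le_one₀ (pow_le_one₀ ha0 ha1) (by positivity) (pow_le_one₀ hb0 hb1)

lemma integrable_pow {Z : Ω → ℕ} (hZ : Measurable Z) {a : ℝ} (ha0 : 0 ≤ a) (ha1 : a ≤ 1) :
    Integrable (fun ω => a ^ Z ω) P := by
  simpa using integrable_pow_mul_pow (P := P) hZ hZ ha0 ha1 zero_le_one le_rfl

/-- The function `φ` attached to a mean one offspring law through its generating function
`s + (1 - s) ^ (1 + α) * L (1 - s)`. -/
lemma isCritRate_of_pgf {Z : Ω → ℕ} (hZ : Measurable Z) (hmean : ∫ ω, (Z ω : ℝ) ∂P = 1)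
    {α : ℝ} (hα : 0 < α) {L : ℝ → ℝ}
    (hF : ∀ s : ℝ, 0 ≤ s → s < 1 → ∫ ω, s ^ Z ω ∂P = s + (1 - s) ^ (1 + α) * L (1 - s))
    (hL : ∀ c : ℝ, 0 < c → Tendsto (fun x => L (c * x) / L x) (𝓝[>] 0) (𝓝 1)) :
    IsCritRate (fun x => x ^ α * L x) := by
  have hInt : Integrable (fun ω => (Z ω : ℝ)) P := by
    by_contra h
    rw [integral_undef h] at hmean
    exact zero_ne_one hmean
  set φ : ℝ → ℝ := fun x => x ^ α * L x with hφ
  have hstep : ∀ x, 0 < x → x ≤ 1 → x * (1 - φ x) = 1 - ∫ ω, (1 - x) ^ Z ω ∂P := by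
    intro x h0 h1
    rw [hF (1 - x) (by linarith) (by linarith), sub_sub_cancel, Real.rpow_add h0, Real.rpow_one]
    ring
  have hgint : ∀ s : ℝ, 0 ≤ s → s ≤ 1 →
      Integrable (fun ω => ∑ j ∈ Finset.range (Z ω), s ^ j) P := by
    intro s h0 h1
    refine hInt.mono' ((measurable_from_nat
      (f := fun k => ∑ j ∈ Finset.range k, s ^ j)).comp hZ).aestronglyMeasurable
      (ae_of_all _ fun ω => ?_)
    rw [Real.norm_of_nonneg (by positivity)]
    calc ∑ j ∈ Finset.range (Z ω), s ^ j ≤ ∑ j ∈ Finset.range (Z ω), (1 : ℝ) :=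
          Finset.sum_le_sum fun j _ => pow_le_one₀ h0 h1
      _ = Z ω := by simp
  have hrate : ∀ x, 0 < x → x ≤ 1 →
      φ x = 1 - ∫ ω, ∑ j ∈ Finset.range (Z ω), (1 - x) ^ j ∂P := by
    intro x h0 h1
    have h2 : ∫ ω, (1 - (1 - x) ^ Z ω) ∂P
        = x * ∫ ω, ∑ j ∈ Finset.range (Z ω), (1 - x) ^ j ∂P := by
      rw [← integral_const_mul]
      refine integral_congr_ae (ae_of_all _ fun ω => ?_)
      have := mul_neg_geom_sum (1 - x) (Z ω)
      simp only at this ⊢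
      rw [← this]; ring
    rw [integral_sub (integrable_const _) (integrable_pow hZ (by linarith) (by linarith))] at h2
    have h3 := hstep x h0 h1
    simp only [integral_const, probReal_univ, smul_eq_mul, mul_one] at h2
    rw [h2] at h3
    have := mul_left_cancel₀ h0.ne' h3
    linarith
  have hmono : ∀ x y, 0 < x → x ≤ y → y ≤ 1 → φ x ≤ φ y := by
    intro x y h0 hxy h1
    rw [hrate x h0 (hxy.trans h1), hrate y (h0.trans_le hxy) h1]
    have := integral_mono (hgint (1 - y) (by linarith) (by linarith))
      (hgint (1 - x) (by linarith) (by linarith)) (fun ω => Finset.sum_le_sum fun j _ =>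
        pow_le_pow_left₀ (by linarith) (by linarith : 1 - y ≤ 1 - x) j)
    linarith
  have hnonneg : ∀ x, 0 < x → x ≤ 1 → 0 ≤ φ x := by
    intro x h0 h1
    rw [hrate x h0 h1]
    have := integral_mono (hgint (1 - x) (by linarith) (by linarith)) hInt (fun ω => by
      calc ∑ j ∈ Finset.range (Z ω), (1 - x) ^ j ≤ ∑ j ∈ Finset.range (Z ω), (1 : ℝ) :=
          Finset.sum_le_sum fun j _ => pow_le_one₀ (by linarith) (by linarith)
        _ = Z ω := by simp)
    linarith
  have hLne : ∀ᶠ x in 𝓝[>] (0 : ℝ), L x ≠ 0 := by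
    filter_upwards [(hL 1 one_pos).eventually_ne one_ne_zero] with x hx h
    simp [h] at hx
  have hpos : ∀ x, 0 < x → x ≤ 1 → 0 < φ x := by
    intro x h0 h1
    obtain ⟨y, hy, hy0, hyx⟩ := (hLne.and (Ioo_mem_nhdsGT h0)).exists
    have h2 : φ y ≠ 0 := mul_ne_zero (Real.rpow_pos_of_pos hy0 _).ne' hy
    exact ((hnonneg y hy0 (hyx.le.trans h1)).lt_of_ne' h2).trans_le (hmono y x hy0 hyx.le h1)
  have hratio : ∀ c : ℝ, 0 < c → Tendsto (fun x => φ (c * x) / φ x) (𝓝[>] 0) (𝓝 (c ^ α)) := by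
    intro c hc
    have h1 := (hL c hc).const_mul (c ^ α)
    rw [mul_one] at h1
    refine h1.congr' ?_
    filter_upwards [self_mem_nhdsWithin] with x hx
    have hx0 : 0 < x := hx
    have hxa := (Real.rpow_pos_of_pos hx0 α).ne'
    simp only [hφ]
    rw [Real.mul_rpow hc.le hx0.le]
    field_simp
  have hlocal : ∀ c C : ℝ, 0 < c → c ^ α < C →
      ∃ δ > 0, ∀ x, 0 < x → x ≤ δ → φ (c * x) ≤ C * φ x := by
    intro c C hc hC
    have h1 := (hratio c hc).eventually (Iio_mem_nhds hC)
    obtain ⟨δ, hδ, hδs⟩ := mem_nhdsGT_iff_exists_Ioc_subset.1 h1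
    refine ⟨min δ 1, lt_min hδ one_pos, fun x h0 hx => ?_⟩
    have h2 : φ (c * x) / φ x < C := hδs ⟨h0, hx.trans (min_le_left _ _)⟩
    rw [div_lt_iff₀ (hpos x h0 (hx.trans (min_le_right _ _)))] at h2
    exact h2.le
  refine ⟨hpos, ?_, hmono, ?_, ?_, ?_⟩
  · intro x h0 h1
    have h2 := hrate x h0 h1
    have hnn : ∀ ω, 0 ≤ ∑ j ∈ Finset.range (Z ω), (1 - x) ^ j := fun ω =>
      Finset.sum_nonneg fun j _ => pow_nonneg (by linarith) j
    have hInt_nonneg : 0 ≤ ∫ ω, ∑ j ∈ Finset.range (Z ω), (1 - x) ^ j ∂P := integral_nonneg hnn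
    rcases hInt_nonneg.eq_or_lt with h | h
    · exfalso
      have h3 := (integral_eq_zero_iff_of_nonneg (fun ω => hnn ω) (hgint (1 - x) (by linarith)
        (by linarith))).1 h.symm
      have h4 : (fun ω => (Z ω : ℝ)) =ᵐ[P] 0 := by
        filter_upwards [h3] with ω hω
        by_contra hne
        have hz : 0 < Z ω := Nat.pos_of_ne_zero fun h => hne (by simp [h])
        have h5 : (1 - x) ^ 0 ≤ ∑ j ∈ Finset.range (Z ω), (1 - x) ^ j :=
          Finset.single_le_sum (f := fun j => (1 - x) ^ j)
            (fun j _ => pow_nonneg (by linarith) j) (Finset.mem_range.2 hz)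
        simp only [Pi.zero_apply] at hω
        rw [hω] at h5
        norm_num at h5
      rw [integral_congr_ae h4] at hmean
      simp at hmean
    · linarith
  · intro x y h0 hxy h1
    rcases h0.eq_or_lt with rfl | h0
    · rw [zero_mul]
      rcases hxy.eq_or_lt with rfl | hy
      · simp
      · rw [hstep y hy h1]
        have := integral_mono (integrable_pow (P := P) hZ (by linarith : 0 ≤ 1 - y) (by linarith))
          (integrable_const 1) (fun ω => pow_le_one₀ (by linarith) (by linarith))
        simp at this
        linarith
    · rw [hstep x h0 (hxy.trans h1), hstep y (h0.trans_le hxy) h1]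
      have := integral_mono (integrable_pow (P := P) hZ (by linarith : 0 ≤ 1 - y) (by linarith))
        (integrable_pow hZ (by linarith : 0 ≤ 1 - x) (by linarith))
        (fun ω => pow_le_pow_left₀ (by linarith) (by linarith : 1 - y ≤ 1 - x) (Z ω))
      linarith
  · obtain ⟨δ, hδ, h⟩ := hlocal 2 (2 ^ α + 1) two_pos (by linarith)
    exact ⟨2 ^ α + 1, by positivity, δ, hδ, h⟩
  · have h1 : (1 / 2 : ℝ) ^ α < 1 := Real.rpow_lt_one (by norm_num) (by norm_num) hα
    obtain ⟨C, hC1, hC2⟩ := exists_between h1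
    obtain ⟨δ, hδ, h⟩ := hlocal (1 / 2) C (by norm_num) hC1
    refine ⟨C, hC2, δ, hδ, fun x h0 hx => ?_⟩
    have := h x h0 hx
    rwa [one_div_mul_eq_div] at this

lemma measure_toReal_eq_one_sub_integral {A : Set Ω} (hA : MeasurableSet A) {f : Ω → ℝ}
    (hf0 : ∀ ω ∈ A, f ω = 0) (hf1 : ∀ ω ∉ A, f ω = 1) :
    (P A).toReal = 1 - ∫ ω, f ω ∂P := by
  have h : f = Aᶜ.indicator 1 := by
    ext ω
    by_cases hω : ω ∈ A
    · simp [hω, hf0 ω hω]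
    · simp [hω, hf1 ω hω]
  rw [h, integral_indicator_one hA.compl, probReal_compl_eq_one_sub hA]
  simp [Measure.real]

end PGF

namespace GWSetup

variable (S : GWSetup)

attribute [local instance] GWSetup.mΩ GWSetup.hprob1 GWSetup.hprob2

/-- The decrease rate of the type 1 survival probability. -/
noncomputable def rate1 (x : ℝ) : ℝ := x ^ S.α1 * S.L1 x

/-- The decrease rate of the type 2 survival probability. -/
noncomputable def rate2 (x : ℝ) : ℝ := x ^ S.α2 * S.L2 x

lemma F21_one_left (n : ℕ) (s : ℝ) : S.F21 n 1 s = ∫ ω, s ^ S.Z2 n ω ∂S.P2 := by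
  simp [F21]

lemma isCritRate_rate1 : IsCritRate S.rate1 :=
  isCritRate_of_pgf (S.mZ1 1) S.hcrit1 S.hα1.1 S.hF1 S.hL1

lemma isCritRate_rate2 : IsCritRate S.rate2 := by
  refine isCritRate_of_pgf (S.mZ2 1) S.hcrit2 S.hα2.1 (fun s h0 h1 => ?_) S.hL2
  have := S.hF2 1 s zero_le_one le_rfl h0 h1
  simpa using this

lemma F1_zero (s : ℝ) : S.F1 0 s = s := by
  have : (fun ω => s ^ S.Z1 0 ω) =ᵐ[S.P1] fun _ => s := by
    filter_upwards [S.hinit1] with ω hω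
    simp [hω.1]
  simp [F1, integral_congr_ae this]

lemma F21_zero (a b : ℝ) : S.F21 0 a b = b := by
  have : (fun ω => a ^ S.Z1 0 ω * b ^ S.Z2 0 ω) =ᵐ[S.P2] fun _ => b := by
    filter_upwards [S.hinit2] with ω hω
    simp [hω.1, hω.2]
  simp [F21, integral_congr_ae this]

lemma F1_one_right (n : ℕ) : S.F1 n 1 = 1 := by simp [F1]

lemma F1_add (m n : ℕ) {s : ℝ} (h0 : 0 ≤ s) (h1 : s ≤ 1) :
    S.F1 (m + n) s = S.F1 m (S.F1 n s) := S.hbranch1 m n s h0 h1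

lemma F21_add (m n : ℕ) {a b : ℝ} (ha0 : 0 ≤ a) (ha1 : a ≤ 1) (hb0 : 0 ≤ b) (hb1 : b ≤ 1) :
    S.F21 (m + n) a b = S.F21 m (S.F1 n a) (S.F21 n a b) := S.hbranch2 m n a b ha0 ha1 hb0 hb1

lemma integrable_F21 (n : ℕ) {a b : ℝ} (ha0 : 0 ≤ a) (ha1 : a ≤ 1) (hb0 : 0 ≤ b) (hb1 : b ≤ 1) :
    Integrable (fun ω => a ^ S.Z1 n ω * b ^ S.Z2 n ω) S.P2 :=
  integrable_pow_mul_pow (S.mZ1 n) (S.mZ2 n) ha0 ha1 hb0 hb1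

lemma F1_nonneg (n : ℕ) {s : ℝ} (h0 : 0 ≤ s) : 0 ≤ S.F1 n s :=
  integral_nonneg fun _ => pow_nonneg h0 _

lemma F21_nonneg (n : ℕ) {a b : ℝ} (ha0 : 0 ≤ a) (hb0 : 0 ≤ b) : 0 ≤ S.F21 n a b :=
  integral_nonneg fun _ => mul_nonneg (pow_nonneg ha0 _) (pow_nonneg hb0 _)

lemma F1_le_one (n : ℕ) {s : ℝ} (h0 : 0 ≤ s) (h1 : s ≤ 1) : S.F1 n s ≤ 1 := by
  have := integral_mono (integrable_pow (P := S.P1) (S.mZ1 n) h0 h1) (integrable_const 1)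
    fun _ => pow_le_one₀ h0 h1
  simpa [F1] using this

lemma F21_mono (n : ℕ) {a b a' b' : ℝ} (ha0 : 0 ≤ a) (haa : a ≤ a') (ha1 : a' ≤ 1)
    (hb0 : 0 ≤ b) (hbb : b ≤ b') (hb1 : b' ≤ 1) : S.F21 n a b ≤ S.F21 n a' b' :=
  integral_mono (S.integrable_F21 n ha0 (haa.trans ha1) hb0 (hbb.trans hb1))
    (S.integrable_F21 n (ha0.trans haa) ha1 (hb0.trans hbb) hb1) fun _ =>
      mul_le_mul (pow_le_pow_left₀ ha0 haa _) (pow_le_pow_left₀ hb0 hbb _)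
        (pow_nonneg hb0 _) (pow_nonneg (ha0.trans haa) _)

lemma F21_le_one (n : ℕ) {a b : ℝ} (ha0 : 0 ≤ a) (ha1 : a ≤ 1) (hb0 : 0 ≤ b) (hb1 : b ≤ 1) :
    S.F21 n a b ≤ 1 := by
  have := S.F21_mono n ha0 ha1 le_rfl hb0 hb1 le_rfl
  simpa [F21] using this

lemma one_sub_F21_one_one {y : ℝ} (h0 : 0 < y) (h1 : y ≤ 1) :
    1 - S.F21 1 1 (1 - y) = y * (1 - S.rate2 y) := by
  have := S.hF2 1 (1 - y) zero_le_one le_rfl (by linarith) (by linarith)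
  rw [F21, this, rate2, sub_sub_cancel, Real.rpow_add h0, Real.rpow_one]
  ring

lemma isRateOrbit1 {x : ℝ} (h0 : 0 < x) (h1 : x ≤ 1) :
    IsRateOrbit S.rate1 fun k => 1 - S.F1 k (1 - x) := by
  refine IsRateOrbit.of_zero S.isCritRate_rate1 (by simpa [F1_zero]) (by simpa [F1_zero])
    fun k hk0 hk1 => ?_
  have h2 := S.hF1 (S.F1 k (1 - x)) (S.F1_nonneg k (by linarith)) (by linarith)
  rw [add_comm k 1, S.F1_add 1 k (by linarith) (by linarith)]
  nth_rw 1 [F1]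
  rw [h2, rate1, Real.rpow_add hk0, Real.rpow_one]
  ring

lemma isRateOrbit2 {y : ℝ} (h0 : 0 < y) (h1 : y ≤ 1) :
    IsRateOrbit S.rate2 fun k => 1 - S.F21 k 1 (1 - y) := by
  refine IsRateOrbit.of_zero S.isCritRate_rate2 (by simpa [F21_zero]) (by simpa [F21_zero])
    fun k hk0 hk1 => ?_
  rw [add_comm k 1, S.F21_add 1 k zero_le_one le_rfl (by linarith) (by linarith), F1_one_right,
    ← S.one_sub_F21_one_one hk0 hk1, sub_sub_cancel]

lemma Q1_eq (n : ℕ) : S.Q1 n = 1 - S.F1 n 0 :=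
  measure_toReal_eq_one_sub_integral (S.mZ1 n (measurableSet_singleton 0).compl)
    (fun _ hω => zero_pow hω) fun ω hω => by simp [show S.Z1 n ω = 0 by simpa using hω]

lemma Q2_eq (n : ℕ) : S.Q2 n = 1 - S.F21 n 1 0 := by
  rw [F21_one_left]
  exact measure_toReal_eq_one_sub_integral (S.mZ2 n (measurableSet_singleton 0).compl)
    (fun _ hω => zero_pow hω) fun ω hω => by simp [show S.Z2 n ω = 0 by simpa using hω]

lemma measurableSet_surv (n : ℕ) : MeasurableSet (S.surv n) :=
  (S.mZ1 n (measurableSet_singleton 0).compl).union (S.mZ2 n (measurableSet_singleton 0).compl)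

lemma Q21_eq (n : ℕ) : S.Q21 n = 1 - S.F21 n 0 0 := by
  refine measure_toReal_eq_one_sub_integral (S.measurableSet_surv n) (fun ω hω => ?_)
    fun ω hω => ?_
  · rcases hω with h | h <;> simp [h]
  · simp only [surv, Set.mem_ofPred_eq, not_or, not_not] at hω
    simp [hω.1, hω.2]

lemma isRateOrbit_Q1 : IsRateOrbit S.rate1 S.Q1 := by
  have := S.isRateOrbit1 one_pos le_rfl
  rwa [sub_self, ← funext S.Q1_eq] at this

lemma isRateOrbit_Q2 : IsRateOrbit S.rate2 S.Q2 := by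
  have := S.isRateOrbit2 one_pos le_rfl
  rwa [sub_self, ← funext S.Q2_eq] at this

lemma Q21_le_one (n : ℕ) : S.Q21 n ≤ 1 := by
  rw [Q21_eq]; linarith [S.F21_nonneg n le_rfl le_rfl]

lemma Q2_le_Q21 (n : ℕ) : S.Q2 n ≤ S.Q21 n := by
  rw [Q21_eq, Q2_eq]
  linarith [S.F21_mono n le_rfl zero_le_one le_rfl le_rfl le_rfl (zero_le_one (α := ℝ))]

lemma Q21_pos (n : ℕ) : 0 < S.Q21 n := (S.isRateOrbit_Q2.pos n).trans_le (S.Q2_le_Q21 n)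

lemma Q21_antitone : Antitone S.Q21 := by
  refine antitone_nat_of_succ_le fun n => ?_
  rw [Q21_eq, Q21_eq, S.F21_add n 1 le_rfl zero_le_one le_rfl zero_le_one]
  have := S.F21_mono n le_rfl (S.F1_nonneg 1 le_rfl) (S.F1_le_one 1 le_rfl zero_le_one) le_rfl
    (S.F21_nonneg 1 le_rfl le_rfl) (S.F21_le_one 1 le_rfl zero_le_one le_rfl zero_le_one)
  linarith

lemma Q21_add (m k : ℕ) : S.Q21 (m + k) = 1 - S.F21 m (1 - S.Q1 k) (1 - S.Q21 k) := by
  rw [Q21_eq, S.F21_add m k le_rfl zero_le_one le_rfl zero_le_one, Q1_eq, Q21_eq, sub_sub_cancel,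
    sub_sub_cancel]

lemma one_sub_F21_one_le {a b : ℝ} (ha0 : 0 ≤ a) (ha1 : a ≤ 1) (hb0 : 0 ≤ b) (hb1 : b ≤ 1) :
    1 - S.F21 1 (1 - a) (1 - b) ≤ (1 - S.F21 1 1 (1 - b)) + S.A21 * a := by
  have hInt : Integrable (fun ω => (S.Z1 1 ω : ℝ)) S.P2 := by
    by_contra h
    have := S.hmean21
    rw [integral_undef h] at this
    exact S.hA21.ne this
  have h1 := S.integrable_F21 1 (a := 1 - a) (b := 1 - b) (by linarith) (by linarith) (by linarith)
    (by linarith)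
  have h2 := integral_mono (S.integrable_F21 1 (a := 1) (b := 1 - b) zero_le_one le_rfl
    (by linarith) (by linarith)) (h1.add (hInt.mul_const a)) fun ω => by
      have h3 : 1 + (S.Z1 1 ω : ℝ) * (-a) ≤ (1 + -a) ^ S.Z1 1 ω :=
        one_add_mul_le_pow (by linarith) _
      have h4 : (1 - b) ^ S.Z2 1 ω ≤ 1 := pow_le_one₀ (by linarith) (by linarith)
      have h5 : 0 ≤ (1 - b) ^ S.Z2 1 ω := pow_nonneg (by linarith) _
      have h6 : 0 ≤ (S.Z1 1 ω : ℝ) * a := by positivity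
      rw [← sub_eq_add_neg] at h3
      simp only [one_pow, one_mul, Pi.add_apply]
      nlinarith
  rw [integral_add' h1 (hInt.mul_const a), integral_mul_const, S.hmean21] at h2
  simp only [F21]
  linarith

lemma one_sub_F21_le (m : ℕ) {x y : ℝ} (hx0 : 0 < x) (hx1 : x ≤ 1) (hy0 : 0 < y) (hy1 : y ≤ 1) :
    1 - S.F21 m (1 - x) (1 - y) ≤ y + m * S.A21 * x := by
  induction m with
  | zero => simp [F21_zero]
  | succ m ih =>
    have ho := S.isRateOrbit1 hx0 hx1
    set u := 1 - S.F1 m (1 - x) with hu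
    set v := 1 - S.F21 m (1 - x) (1 - y) with hv
    have hu0 : 0 ≤ u := (ho.pos m).le
    have hux : u ≤ x := by
      have := ho.antitone S.isCritRate_rate1 (Nat.zero_le m)
      simp only [F1_zero] at this
      linarith
    have hv0 : 0 ≤ v := by
      linarith [S.F21_le_one m (a := 1 - x) (b := 1 - y) (by linarith) (by linarith) (by linarith)
        (by linarith)]
    have hv1 : v ≤ 1 := by
      linarith [S.F21_nonneg m (a := 1 - x) (b := 1 - y) (by linarith) (by linarith)]
    rw [add_comm m 1, S.F21_add 1 m (by linarith) (by linarith) (by linarith) (by linarith)]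
    have h1 := S.one_sub_F21_one_le hu0 (hux.trans hx1) hv0 hv1
    rw [hu, hv, sub_sub_cancel, sub_sub_cancel, ← hu] at h1
    have h2 : 1 - S.F21 1 1 (S.F21 m (1 - x) (1 - y)) ≤ v := by
      rcases hv0.eq_or_lt with h | h
      · rw [show S.F21 m (1 - x) (1 - y) = 1 by linarith, F21_one_left]
        simpa using hv0
      · have h3 := S.one_sub_F21_one_one h hv1
        rw [hv, sub_sub_cancel, ← hv] at h3
        rw [h3]
        nlinarith [S.isCritRate_rate2.pos v h hv1]
    have h3 := mul_le_mul_of_nonneg_left hux S.hA21.le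
    push_cast
    linarith

lemma le_one_sub_F21 (m : ℕ) {x y : ℝ} (hx0 : 0 ≤ x) (hx1 : x ≤ 1) (hy0 : 0 < y) (hy1 : y ≤ 1) :
    y * (1 - m * S.rate2 y) ≤ 1 - S.F21 m (1 - x) (1 - y) := by
  have h1 := (S.isRateOrbit2 hy0 hy1).mul_one_sub_le S.isCritRate_rate2 0 m
  simp only [F21_zero, sub_sub_cancel, zero_add] at h1
  have h2 := S.F21_mono m (a := 1 - x) (a' := 1) (b := 1 - y) (b' := 1 - y) (by linarith)
    (by linarith) le_rfl (by linarith) le_rfl (by linarith)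
  linarith

lemma le_Q21_add (m k : ℕ) {y : ℝ} (hy0 : 0 < y) (hy : y ≤ S.Q21 k) :
    y * (1 - m * S.rate2 y) ≤ S.Q21 (m + k) := by
  have hr := S.Q21_le_one k
  have hp := S.isRateOrbit_Q1
  have h1 := S.le_one_sub_F21 m (hp.pos k).le (hp.le_one k) hy0 (hy.trans hr)
  have h2 := S.F21_mono m (a := 1 - S.Q1 k) (a' := 1 - S.Q1 k) (b := 1 - S.Q21 k) (b' := 1 - y)
    (by linarith [hp.le_one k]) le_rfl (by linarith [hp.pos k]) (by linarith) (by linarith)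
    (by linarith)
  rw [Q21_add]
  linarith

lemma Q21_succ_le (k : ℕ) :
    S.Q21 (k + 1) ≤ S.Q21 k * (1 - S.rate2 (S.Q21 k)) + S.A21 * S.Q1 k := by
  have hp := S.isRateOrbit_Q1
  rw [add_comm k 1, Q21_add, ← S.one_sub_F21_one_one (S.Q21_pos k) (S.Q21_le_one k)]
  exact S.one_sub_F21_one_le (hp.pos k).le (hp.le_one k) (S.Q21_pos k).le (S.Q21_le_one k)

lemma tendsto_Q1 : Tendsto S.Q1 atTop (𝓝 0) :=
  S.isRateOrbit_Q1.tendsto_zero S.isCritRate_rate1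

lemma tendsto_Q21 : Tendsto S.Q21 atTop (𝓝 0) :=
  S.isCritRate_rate2.tendsto_zero S.Q21_antitone S.Q21_pos S.Q21_le_one S.Q21_succ_le
    (by simpa using S.tendsto_Q1.const_mul S.A21)

lemma eventually_le_Q21_succ : ∀ᶠ k in atTop,
    S.Q21 k * (1 - S.rate2 (S.Q21 k)) + S.A21 / 2 * S.Q1 k ≤ S.Q21 (k + 1) := by
  obtain ⟨δ, hδ, hρ⟩ := S.hρ (S.A21 / 2) (half_pos S.hA21)
  have hlim : Tendsto (fun k => (1 - S.Q1 k) * (1 - S.Q21 k)) atTop (𝓝 ((1 - 0) * (1 - 0))) :=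
    (S.tendsto_Q1.const_sub 1).mul (S.tendsto_Q21.const_sub 1)
  have hp := S.isRateOrbit_Q1
  filter_upwards [hlim.eventually (Ioi_mem_nhds (by linarith : 1 - δ < (1 - 0) * (1 - 0)))]
    with k hk
  have hp0 := hp.pos k
  have hp1 := hp.le_one k
  have hr0 := S.Q21_pos k
  have hr1 := S.Q21_le_one k
  have h1 := abs_lt.1 (hρ _ _ (by linarith) (by linarith) (by linarith) (by linarith) hk)
  have h2 := S.hF2 (1 - S.Q1 k) (1 - S.Q21 k) (by linarith) (by linarith) (by linarith)
    (by linarith)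
  rw [add_comm k 1, Q21_add, F21, h2, sub_sub_cancel, sub_sub_cancel, Real.rpow_add hr0,
    Real.rpow_one, rate2]
  nlinarith

end GWSetup

namespace GWSetup

attribute [local instance] GWSetup.mΩ GWSetup.hprob1 GWSetup.hprob2

variable (S : GWSetup)

/-- The type 1 immigration forces `Q₂₁(n)` to be at least of the order of the smaller of `n Q₁(n)`
and the level at which the type 2 decrease compensates the immigration. -/
lemma exists_Q21_lower : ∃ c > 0, ∀ᶠ n : ℕ in atTop,
    c * S.Q1 n ≤ S.Q21 n * S.rate2 (S.Q21 n) ∨ c * (n * S.Q1 n) ≤ S.Q21 n := by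
  obtain ⟨N, hN⟩ := eventually_atTop.1 S.eventually_le_Q21_succ
  have hA := S.hA21
  have hp := S.isRateOrbit_Q1
  refine ⟨S.A21 / 8, by positivity, ?_⟩
  filter_upwards [eventually_ge_atTop (2 * N + 1)] with n hn
  by_contra! hcon
  obtain ⟨h1, h2⟩ := hcon
  have hpn := hp.pos n
  set e := S.A21 / 4 * S.Q1 n with he
  have he0 : 0 < e := by positivity
  have hstep : ∀ k, N ≤ k → k ≤ n → ∀ x, 0 ≤ x → x ≤ S.Q21 n → x ≤ S.Q21 k →
      x + e ≤ S.Q21 (k + 1) := by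
    intro k hNk hkn x hx0 hxn hxk
    have h3 := hN k hNk
    have h4 : S.Q1 n ≤ S.Q1 k := hp.antitone S.isCritRate_rate1 hkn
    have h5 := S.isCritRate_rate2.step_mono x _ hx0 hxk (S.Q21_le_one k)
    have h6 : x * S.rate2 x ≤ S.Q21 n * S.rate2 (S.Q21 n) := by
      rcases hx0.eq_or_lt with rfl | hx0
      · have := S.isCritRate_rate2.pos _ (S.Q21_pos n) (S.Q21_le_one n)
        have := S.Q21_pos n
        rw [zero_mul]
        positivity
      · exact mul_le_mul hxn (S.isCritRate_rate2.mono _ _ hx0 hxn (S.Q21_le_one n))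
          (S.isCritRate_rate2.pos _ hx0 (hxn.trans (S.Q21_le_one n))).le (S.Q21_pos n).le
    nlinarith
  have hind : ∀ j, N + j ≤ n → min (S.Q21 n) (j * e) ≤ S.Q21 (N + j) := by
    intro j
    induction j with
    | zero =>
      intro _
      simpa using Or.inr (S.Q21_pos N).le
    | succ j ih =>
      intro hj
      have h3 := hstep (N + j) (by omega) (by omega) _
        (le_min (S.Q21_pos n).le (by positivity)) (min_le_left _ _) (ih (by omega))
      rw [← add_assoc]
      refine le_trans ?_ h3
      rw [min_add]
      refine min_le_min (by linarith) ?_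
      push_cast
      linarith
  obtain ⟨j, hj⟩ : ∃ j, n = N + j + 1 := ⟨n - N - 1, by omega⟩
  have h3 := hstep (N + j) (by omega) (by omega) _
    (le_min (S.Q21_pos n).le (by positivity)) (min_le_left _ _) (hind j (by omega))
  rw [← hj] at h3
  rcases le_total (S.Q21 n) (j * e) with h | h
  · rw [min_eq_left h] at h3
    linarith
  · rw [min_eq_right h] at h3
    have h4 : (n : ℝ) ≤ 2 * (j + 1) := by
      have : n ≤ 2 * (j + 1) := by omega
      exact_mod_cast this
    have h5 : (n : ℝ) * S.Q1 n ≤ 2 * (j + 1) * S.Q1 n := by gcongr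
    rw [he] at h3
    nlinarith

/-- Under Condition (B) the type 2 particles alone do not ensure survival. -/
lemma eventually_two_mul_Q2_lt (hB : S.CondB) : ∀ᶠ n : ℕ in atTop, 2 * S.Q2 n < S.Q21 n := by
  obtain ⟨c, hc, hlow⟩ := S.exists_Q21_lower
  obtain ⟨C, hC, δ, hδ, hdouble⟩ := S.isCritRate_rate2.double
  have hq := S.isRateOrbit_Q2
  obtain ⟨D, hD, hrate⟩ := hq.exists_mul_rate_le S.isCritRate_rate2
  have hq0 := hq.tendsto_zero S.isCritRate_rate2
  set ε := min (c / 2) (c / (2 * C * D)) with hε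
  have hε0 : 0 < ε := by positivity
  filter_upwards [hlow, hq0.eventually (Iic_mem_nhds hδ),
    hq0.eventually (Iic_mem_nhds (by norm_num : (0 : ℝ) < 1 / 2)),
    hB.eventually (Iio_mem_nhds hε0), eventually_gt_atTop 0] with n hn hqδ hq2 hBn hn0
  by_contra! hcon
  have hqp := hq.pos n
  have hpp := S.isRateOrbit_Q1.pos n
  have hnp : (0 : ℝ) < n := by exact_mod_cast hn0
  have hBn' : S.Q2 n < ε * (n * S.Q1 n) := by
    rwa [div_lt_iff₀ (by positivity)] at hBn
  have hlt : ∀ K, ε ≤ K → S.Q2 n < K * (n * S.Q1 n) := fun K hK =>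
    hBn'.trans_le (by gcongr)
  rcases hn with h | h
  · have h1 : S.rate2 (S.Q21 n) ≤ C * S.rate2 (S.Q2 n) :=
      (S.isCritRate_rate2.mono _ _ (S.Q21_pos n) hcon (by linarith [hq2])).trans
        (hdouble _ hqp hqδ)
    have h2 : c * S.Q1 n ≤ 2 * S.Q2 n * (C * S.rate2 (S.Q2 n)) :=
      h.trans (mul_le_mul hcon h1
        (S.isCritRate_rate2.pos _ (S.Q21_pos n) (S.Q21_le_one n)).le (by positivity))
    have h3 : c * (n * S.Q1 n) ≤ 2 * C * D * S.Q2 n := by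
      calc c * (n * S.Q1 n) = n * (c * S.Q1 n) := by ring
        _ ≤ n * (2 * S.Q2 n * (C * S.rate2 (S.Q2 n))) := by gcongr
        _ = 2 * C * S.Q2 n * (n * S.rate2 (S.Q2 n)) := by ring
        _ ≤ 2 * C * S.Q2 n * D := by gcongr; exact hrate n
        _ = 2 * C * D * S.Q2 n := by ring
    have h4 := hlt _ (min_le_right _ _)
    rw [div_mul_eq_mul_div, lt_div_iff₀ (by positivity)] at h4
    linarith
  · have h4 := hlt _ (min_le_left _ _)
    linarith

section GStar

variable {S} {g m : ℕ → ℕ}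

lemma IsGStar.eventually_bounds (hg : S.IsGStar g) :
    ∀ᶠ n in atTop, S.Q21 n < 2 * S.Q2 (g n) ∧ S.Q2 (g n) < 2 * S.Q21 n := by
  filter_upwards [hg.eventually (Ioo_mem_nhds (by norm_num : (1 / 2 : ℝ) < 1) one_lt_two)] with n hn
  have hr := S.Q21_pos n
  obtain ⟨h1, h2⟩ := hn
  rw [lt_div_iff₀ hr] at h1
  rw [div_lt_iff₀ hr] at h2
  constructor <;> linarith

lemma IsGStar.eventually_lt (hB : S.CondB) (hg : S.IsGStar g) : ∀ᶠ n in atTop, g n < n := by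
  filter_upwards [hg.eventually_bounds, S.eventually_two_mul_Q2_lt hB] with n h1 h2
  by_contra! h
  have := S.isRateOrbit_Q2.antitone S.isCritRate_rate2 h
  linarith

lemma IsGStar.tendsto_Q2 (hg : S.IsGStar g) : Tendsto (fun n => S.Q2 (g n)) atTop (𝓝 0) := by
  refine tendsto_of_tendsto_of_tendsto_of_le_of_le' tendsto_const_nhds
    (by simpa using S.tendsto_Q21.const_mul 2)
    (Eventually.of_forall fun n => (S.isRateOrbit_Q2.pos _).le) ?_
  filter_upwards [hg.eventually_bounds] with n hn using hn.2.le

lemma IsGStar.eventually_pos (hg : S.IsGStar g) : ∀ᶠ n in atTop, 0 < g n := by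
  filter_upwards [hg.tendsto_Q2.eventually (Iio_mem_nhds one_pos)] with n hn
  by_contra! h
  rw [Nat.le_zero.1 h, Q2_eq, F21_zero] at hn
  simp at hn

lemma IsGStar.exists_mul_rate_le (hg : S.IsGStar g) :
    ∃ K > 0, ∀ᶠ n in atTop, (g n : ℝ) * S.rate2 (S.Q21 n) ≤ K := by
  obtain ⟨C, hC, δ, hδ, hdouble⟩ := S.isCritRate_rate2.double
  have hq := S.isRateOrbit_Q2
  obtain ⟨D, hD, hrate⟩ := hq.exists_mul_rate_le S.isCritRate_rate2
  refine ⟨C * D, by positivity, ?_⟩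
  filter_upwards [hg.eventually_bounds, hg.tendsto_Q2.eventually (Iic_mem_nhds hδ),
    hg.tendsto_Q2.eventually (Iic_mem_nhds (by norm_num : (0 : ℝ) < 1 / 2))] with n h1 h2 h3
  have h4 : S.rate2 (S.Q21 n) ≤ C * S.rate2 (S.Q2 (g n)) :=
    (S.isCritRate_rate2.mono _ _ (S.Q21_pos n) h1.1.le (by linarith [h3])).trans
      (hdouble _ (hq.pos _) h2)
  calc (g n : ℝ) * S.rate2 (S.Q21 n) ≤ g n * (C * S.rate2 (S.Q2 (g n))) := by gcongr
    _ = C * (g n * S.rate2 (S.Q2 (g n))) := by ring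
    _ ≤ C * D := by gcongr; exact hrate _

lemma IsGStar.exists_mul_Q1_le (hB : S.CondB) (hg : S.IsGStar g) :
    ∃ K > 0, ∀ᶠ n in atTop, (g n : ℝ) * S.Q1 n ≤ K * S.Q21 n := by
  obtain ⟨c, hc, hlow⟩ := S.exists_Q21_lower
  obtain ⟨K, hK, hrate⟩ := hg.exists_mul_rate_le
  refine ⟨max (K / c) (1 / c), by positivity, ?_⟩
  filter_upwards [hlow, hrate, hg.eventually_lt hB] with n h1 h2 h3
  have hpp := S.isRateOrbit_Q1.pos n
  have hrp := S.Q21_pos n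
  rcases h1 with h | h
  · refine le_trans ?_ (mul_le_mul_of_nonneg_right (le_max_left _ _) hrp.le)
    rw [div_mul_eq_mul_div, le_div_iff₀ hc]
    calc (g n : ℝ) * S.Q1 n * c = g n * (c * S.Q1 n) := by ring
      _ ≤ g n * (S.Q21 n * S.rate2 (S.Q21 n)) := by gcongr
      _ = (g n * S.rate2 (S.Q21 n)) * S.Q21 n := by ring
      _ ≤ K * S.Q21 n := by gcongr
  · refine le_trans ?_ (mul_le_mul_of_nonneg_right (le_max_right _ _) hrp.le)
    rw [div_mul_eq_mul_div, le_div_iff₀ hc, one_mul]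
    have h4 : (g n : ℝ) ≤ n := by exact_mod_cast h3.le
    have h5 : (g n : ℝ) * S.Q1 n ≤ n * S.Q1 n := by gcongr
    nlinarith

variable (hB : S.CondB) (hg : S.IsGStar g)
  (hmg : Tendsto (fun n : ℕ => (m n : ℝ) / (g n : ℝ)) atTop (𝓝 0))

include hg hmg in
lemma IsGStar.tendsto_mul_rate :
    Tendsto (fun n => (m n : ℝ) * S.rate2 (S.Q21 n)) atTop (𝓝 0) := by
  obtain ⟨K, hK, hrate⟩ := hg.exists_mul_rate_le
  refine tendsto_of_tendsto_of_tendsto_of_le_of_le' tendsto_const_nhds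
    (by simpa using hmg.mul_const K) (Eventually.of_forall fun n => ?_) ?_
  · exact mul_nonneg (Nat.cast_nonneg _)
      (S.isCritRate_rate2.pos _ (S.Q21_pos n) (S.Q21_le_one n)).le
  · filter_upwards [hrate, hg.eventually_pos] with n h1 h2
    have hgp : (0 : ℝ) < g n := by exact_mod_cast h2
    calc (m n : ℝ) * S.rate2 (S.Q21 n) = m n / g n * (g n * S.rate2 (S.Q21 n)) := by
          field_simp
      _ ≤ m n / g n * K := by gcongr

include hB hg hmg in
lemma IsGStar.eventually_two_mul_lt : ∀ᶠ n in atTop, 2 * m n < n := by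
  filter_upwards [hg.eventually_lt hB, hg.eventually_pos,
    hmg.eventually (Iio_mem_nhds (by norm_num : (0 : ℝ) < 1 / 2))] with n h1 h2 h3
  have hgp : (0 : ℝ) < g n := by exact_mod_cast h2
  rw [div_lt_iff₀ hgp] at h3
  have h4 : (2 * m n : ℝ) < g n := by linarith
  have h5 : 2 * m n < g n := by exact_mod_cast h4
  omega

include hB hg hmg in
lemma IsGStar.eventually_Q21_sub_le {ε : ℝ} (hε : 0 < ε) (hε1 : ε ≤ 1) :
    ∀ᶠ n in atTop, S.Q21 (n - m n) ≤ (1 + ε) * S.Q21 n := by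
  obtain ⟨C, hC, δ, hδ, hdouble⟩ := S.isCritRate_rate2.double
  have hlim := (hg.tendsto_mul_rate hmg).const_mul ((1 + ε) * C)
  rw [mul_zero] at hlim
  filter_upwards [hg.eventually_two_mul_lt hB hmg, hlim.eventually (Iio_mem_nhds hε),
    S.tendsto_Q21.eventually (Iic_mem_nhds hδ),
    S.tendsto_Q21.eventually (Iic_mem_nhds (by norm_num : (0 : ℝ) < 1 / 2))] with n h1 h2 h3 h4
  by_contra! hcon
  have hr := S.Q21_pos n
  have h5 := S.le_Q21_add (m n) (n - m n) (by positivity) hcon.le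
  rw [Nat.add_sub_cancel' (by omega)] at h5
  have h6 : S.rate2 ((1 + ε) * S.Q21 n) ≤ C * S.rate2 (S.Q21 n) :=
    (S.isCritRate_rate2.mono _ _ (by positivity) (by nlinarith) (by linarith)).trans
      (hdouble _ hr h3)
  have h7 : (m n : ℝ) * S.rate2 ((1 + ε) * S.Q21 n) ≤ m n * (C * S.rate2 (S.Q21 n)) := by gcongr
  have h8 : 1 < (1 + ε) * (1 - m n * S.rate2 ((1 + ε) * S.Q21 n)) := by nlinarith
  nlinarith

include hB hg hmg in
lemma IsGStar.tendsto_Q21_sub_div :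
    Tendsto (fun n => S.Q21 (n - m n) / S.Q21 n) atTop (𝓝 1) := by
  refine (nhds_basis_Icc_pos (1 : ℝ)).tendsto_right_iff.2 fun ε hε => ?_
  filter_upwards [hg.eventually_Q21_sub_le hB hmg (lt_min hε one_pos) (min_le_right _ _)] with n hn
  have hr := S.Q21_pos n
  have h1 : S.Q21 n ≤ S.Q21 (n - m n) := S.Q21_antitone (Nat.sub_le _ _)
  have h2 : (1 + min ε 1) * S.Q21 n ≤ (1 + ε) * S.Q21 n := by gcongr; exact min_le_left _ _
  constructor
  · rw [le_div_iff₀ hr]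
    nlinarith
  · rw [div_le_iff₀ hr]
    linarith

include hB hg hmg in
lemma IsGStar.tendsto_mul_rate_sub :
    Tendsto (fun n => (m n : ℝ) * S.rate2 (S.Q21 (n - m n))) atTop (𝓝 0) := by
  obtain ⟨C, hC, δ, hδ, hdouble⟩ := S.isCritRate_rate2.double
  refine tendsto_of_tendsto_of_tendsto_of_le_of_le' tendsto_const_nhds
    (by simpa using (hg.tendsto_mul_rate hmg).const_mul C) (Eventually.of_forall fun n => ?_) ?_
  · exact mul_nonneg (Nat.cast_nonneg _)
      (S.isCritRate_rate2.pos _ (S.Q21_pos _) (S.Q21_le_one _)).le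
  · filter_upwards [hg.eventually_Q21_sub_le hB hmg one_pos le_rfl,
      S.tendsto_Q21.eventually (Iic_mem_nhds hδ),
      S.tendsto_Q21.eventually (Iic_mem_nhds (by norm_num : (0 : ℝ) < 1 / 2))] with n h1 h2 h3
    have h4 : S.rate2 (S.Q21 (n - m n)) ≤ C * S.rate2 (S.Q21 n) :=
      (S.isCritRate_rate2.mono _ (2 * S.Q21 n) (S.Q21_pos _) (by linarith) (by linarith)).trans
        (hdouble _ (S.Q21_pos n) h2)
    calc (m n : ℝ) * S.rate2 (S.Q21 (n - m n)) ≤ m n * (C * S.rate2 (S.Q21 n)) := by gcongr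
      _ = C * (m n * S.rate2 (S.Q21 n)) := by ring

include hB hg hmg in
lemma IsGStar.eventually_Q1_sub_le : ∀ᶠ n in atTop, S.Q1 (n - m n) ≤ 2 * S.Q1 n := by
  have hp := S.isRateOrbit_Q1
  obtain ⟨D, hD, hrate⟩ := hp.exists_mul_rate_le S.isCritRate_rate1
  filter_upwards [hg.eventually_lt hB, hg.eventually_pos, hg.eventually_two_mul_lt hB hmg,
    hmg.eventually (Iio_mem_nhds (by positivity : (0 : ℝ) < 1 / (4 * D)))] with n h1 h2 h3 h4
  have hgp : (0 : ℝ) < g n := by exact_mod_cast h2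
  have hgn : (g n : ℝ) ≤ n := by exact_mod_cast h1.le
  set k := n - m n with hk
  have hnk : (n : ℝ) ≤ 2 * k := by
    have : n ≤ 2 * k := by omega
    exact_mod_cast this
  have hkp : (0 : ℝ) < k := by linarith
  have hpk := hp.pos k
  have hφ := S.isCritRate_rate1.pos _ hpk (hp.le_one k)
  have h5 : (m n : ℝ) * (2 * D) ≤ k := by
    rw [div_lt_div_iff₀ hgp (by positivity)] at h4
    nlinarith
  have h6 : (m n : ℝ) * S.rate1 (S.Q1 k) ≤ 1 / 2 := by
    have h7 := hrate k
    have h8 : (m n : ℝ) * (2 * D) * S.rate1 (S.Q1 k) ≤ k * S.rate1 (S.Q1 k) := by gcongr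
    by_contra! h9
    nlinarith
  have h7 := hp.mul_one_sub_le S.isCritRate_rate1 k (m n)
  rw [hk, Nat.sub_add_cancel (by omega), ← hk] at h7
  nlinarith

include hB hg hmg in
lemma IsGStar.tendsto_mul_Q1_sub_div :
    Tendsto (fun n => (m n : ℝ) * S.Q1 (n - m n) / S.Q21 n) atTop (𝓝 0) := by
  obtain ⟨K, hK, hQ1⟩ := hg.exists_mul_Q1_le hB
  have hp := S.isRateOrbit_Q1
  refine tendsto_of_tendsto_of_tendsto_of_le_of_le' tendsto_const_nhds
    (by simpa using hmg.mul_const (2 * K)) (Eventually.of_forall fun n => ?_) ?_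
  · exact div_nonneg (mul_nonneg (Nat.cast_nonneg _) (hp.pos _).le) (S.Q21_pos n).le
  · filter_upwards [hQ1, hg.eventually_pos, hg.eventually_Q1_sub_le hB hmg] with n h1 h2 h3
    have hgp : (0 : ℝ) < g n := by exact_mod_cast h2
    rw [div_le_iff₀ (S.Q21_pos n)]
    calc (m n : ℝ) * S.Q1 (n - m n) ≤ m n * (2 * S.Q1 n) := by gcongr
      _ = m n / g n * 2 * (g n * S.Q1 n) := by field_simp
      _ ≤ m n / g n * 2 * (K * S.Q21 n) := by gcongr
      _ = m n / g n * (2 * K) * S.Q21 n := by ring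

end GStar

/-- The generating function of the reduced process, conditioned on survival. -/
lemma Ered_eq {m n : ℕ} (hmn : m ≤ n) {s1 s2 : ℝ} (h10 : 0 ≤ s1) (h11 : s1 ≤ 1) (h20 : 0 ≤ s2)
    (h21 : s2 ≤ 1) :
    S.Ered m n (fun k l => s1 ^ k * s2 ^ l) =
      1 - (1 - S.F21 m (1 - (1 - s1) * S.Q1 (n - m)) (1 - (1 - s2) * S.Q21 (n - m))) /
        S.Q21 n := by
  have hInt : Integrable (fun ω => s1 ^ S.R1 m n ω * s2 ^ S.R2 m n ω) S.P2 :=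
    integrable_pow_mul_pow (S.mR1 m n) (S.mR2 m n) h10 h11 h20 h21
  have hA := S.measurableSet_surv n
  have h1 := integral_add_compl hA hInt
  have h2 : ∫ ω in (S.surv n)ᶜ, s1 ^ S.R1 m n ω * s2 ^ S.R2 m n ω ∂S.P2 = 1 - S.Q21 n := by
    have h3 : ∀ᵐ ω ∂S.P2, ω ∈ (S.surv n)ᶜ → s1 ^ S.R1 m n ω * s2 ^ S.R2 m n ω = 1 := by
      filter_upwards [S.hext m n] with ω hω hs
      simp only [surv, Set.mem_compl_iff, Set.mem_ofPred_eq, not_or, not_not] at hs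
      simp [hω hs]
    rw [setIntegral_congr_ae hA.compl h3, setIntegral_const, probReal_compl_eq_one_sub hA]
    simp [Q21, Measure.real]
  have h3 : ∫ ω, s1 ^ S.R1 m n ω * s2 ^ S.R2 m n ω ∂S.P2 =
      S.F21 m (1 - (1 - s1) * S.Q1 (n - m)) (1 - (1 - s2) * S.Q21 (n - m)) :=
    S.hreduced m n hmn s1 s2 h10 h11 h20 h21
  have hr := (S.Q21_pos n).ne'
  rw [h2, h3] at h1
  rw [Ered, eq_sub_of_add_eq h1]
  field_simp
  ring

end GWSetup

/-- Theorem `T_zubQ3`(0).  Under Condition (B)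
(`Q₂(n) = o(n Q₁(n))`), with `g*` satisfying `Q₂(g*(n)) ~ Q₂₁(n)`, for any
`s₁, s₂ ∈ (0,1)` and any integer sequence `m(n)` with `1 ≤ m(n) ≪ g*(n)`,
`E[s₁^{Z₁(m,n)} s₂^{Z₂(m,n)} | Z(n) ≠ 0, Z(0) = e₂] → s₂`. -/
theorem condB_early_reduced_pgf (S : GWSetup) (hB : S.CondB)
    (g : ℕ → ℕ) (hg : S.IsGStar g)
    (s1 s2 : ℝ) (hs1 : s1 ∈ Set.Ioo (0 : ℝ) 1) (hs2 : s2 ∈ Set.Ioo (0 : ℝ) 1)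
    (m : ℕ → ℕ) (hm1 : ∀ n, 1 ≤ m n)
    (hmg : Filter.Tendsto (fun n : ℕ => (m n : ℝ) / (g n : ℝ)) Filter.atTop (nhds 0)) :
    Filter.Tendsto (fun n : ℕ => S.Ered (m n) n (fun k l => s1 ^ k * s2 ^ l))
      Filter.atTop (nhds s2) := by
  have hr := S.Q21_pos
  have hp := S.isRateOrbit_Q1
  have hone := hg.tendsto_Q21_sub_div hB hmg
  have hy := hone.const_mul (1 - s2)
  have hlow : Tendsto (fun n => (1 - s2) * (S.Q21 (n - m n) / S.Q21 n) *
      (1 - m n * S.rate2 (S.Q21 (n - m n)))) atTop (𝓝 (1 - s2)) := by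
    simpa using hy.mul ((hg.tendsto_mul_rate_sub hB hmg).const_sub 1)
  have hupp : Tendsto (fun n => (1 - s2) * (S.Q21 (n - m n) / S.Q21 n) +
      S.A21 * (1 - s1) * (m n * S.Q1 (n - m n) / S.Q21 n)) atTop (𝓝 (1 - s2)) := by
    simpa using hy.add ((hg.tendsto_mul_Q1_sub_div hB hmg).const_mul (S.A21 * (1 - s1)))
  obtain ⟨h10, h11⟩ := hs1
  obtain ⟨h20, h21⟩ := hs2
  have hx0 : ∀ k, 0 < (1 - s1) * S.Q1 k := fun k => mul_pos (by linarith) (hp.pos k)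
  have hx1 : ∀ k, (1 - s1) * S.Q1 k ≤ 1 := fun k => by nlinarith [hp.pos k, hp.le_one k]
  have hy0 : ∀ k, 0 < (1 - s2) * S.Q21 k := fun k => mul_pos (by linarith) (hr k)
  have hyr : ∀ k, (1 - s2) * S.Q21 k ≤ S.Q21 k := fun k => by nlinarith [hr k]
  have hsq : Tendsto (fun n => (1 - S.F21 (m n) (1 - (1 - s1) * S.Q1 (n - m n))
      (1 - (1 - s2) * S.Q21 (n - m n))) / S.Q21 n) atTop (𝓝 (1 - s2)) := by
    refine tendsto_of_tendsto_of_tendsto_of_le_of_le hlow hupp (fun n => ?_) fun n => ?_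
    · have hk := S.Q21_le_one (n - m n)
      have h1 := S.le_one_sub_F21 (m n) (hx0 (n - m n)).le (hx1 _) (hy0 (n - m n))
        ((hyr _).trans hk)
      have h2 := S.isCritRate_rate2.mono _ _ (hy0 (n - m n)) (hyr _) hk
      have h3 : (1 - s2) * S.Q21 (n - m n) * (1 - m n * S.rate2 (S.Q21 (n - m n))) ≤
          (1 - s2) * S.Q21 (n - m n) * (1 - m n * S.rate2 ((1 - s2) * S.Q21 (n - m n))) :=
        mul_le_mul_of_nonneg_left (by gcongr) (hy0 _).le
      rw [← mul_div_assoc, div_mul_eq_mul_div]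
      exact div_le_div_of_nonneg_right (h3.trans h1) (hr n).le
    · have h1 := S.one_sub_F21_le (m n) (hx0 (n - m n)) (hx1 _) (hy0 (n - m n))
        ((hyr _).trans (S.Q21_le_one _))
      exact (div_le_div_of_nonneg_right h1 (hr n).le).trans_eq (by ring)
  have hlim := hsq.const_sub 1
  rw [sub_sub_cancel] at hlim
  refine hlim.congr' ?_
  filter_upwards [hg.eventually_two_mul_lt hB hmg] with n hn
  exact (S.Ered_eq (by omega) h10.le h11.le h20.le h21.le).symm
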